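/- Suppose z ∈ ran(A + Σ_{i=1}^m L_i*((K_i* ∘ B_i ∘ K_i) □ (M_i* ∘ D_i ∘ M_i))(L_i · − r_i) + C) and the step sizes satisfy 2μ⁻¹(1−ᾱ) min_{i=1,…,m}{1/τ, 1/θ_{1,i}, 1/θ_{2,i}, 1/γ_{1,i}, 1/γ_{2,i}, 1/σ_i} > 1, where ᾱ = max{ √(τ Σ_{i=1}^m σ_i‖L_i‖²), max_{j=1,…,m} √(θ_{1,j}γ_{1,j}‖K_j‖²), max_{j=1,…,m} √(θ_{2,j}γ_{2,j}‖M_j‖²) }. Then for the sequences generated by Algorithm 3.1 there exists a primal-dual solution (x̄, p̄, q̄, ȳ) to Problem 1.1 such that x_n ⇀ x̄ weakly in H and, for every i = 1,…,m, p_{i,n} ⇀ p̄_i weakly in X_i, q_{i,n} ⇀ q̄_i weakly in Y_i and y_{i,n} ⇀ ȳ_i weakly in G_i as n → +∞. -/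

import Mathlib

open scoped RealInnerProductSpace
open Filter Topology

noncomputable section

def MonoOp {E : Type*} [NormedAddCommGroup E] [InnerProductSpace ℝ E] (A : E → Set E) : Prop :=
  ∀ ⦃x y u v : E⦄, u ∈ A x → v ∈ A y → (0:ℝ) ≤ ⟪x - y, u - v⟫

def MaxMonoOp {E : Type*} [NormedAddCommGroup E] [InnerProductSpace ℝ E] (A : E → Set E) : Prop :=
  MonoOp A ∧ ∀ B : E → Set E, MonoOp B → (∀ x, A x ⊆ B x) → B = A

def invOp {E : Type*} (A : E → Set E) : E → Set E := fun u => {x | u ∈ A x}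

def sumOp {E : Type*} [Add E] (A B : E → Set E) : E → Set E :=
  fun x => {s | ∃ u ∈ A x, ∃ v ∈ B x, s = u + v}

/-- parallel sum `A □ B = (A⁻¹ + B⁻¹)⁻¹` -/
def parOp {E : Type*} [Add E] (A B : E → Set E) : E → Set E :=
  invOp (sumOp (invOp A) (invOp B))

/-- `T* ∘ B ∘ T` -/
def compOp {F G : Type*} [NormedAddCommGroup F] [InnerProductSpace ℝ F] [CompleteSpace F]
    [NormedAddCommGroup G] [InnerProductSpace ℝ G] [CompleteSpace G]
    (T : F →L[ℝ] G) (B : G → Set G) : F → Set F :=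
  fun x => (ContinuousLinearMap.adjoint T) '' (B (T x))

def smulOp {E : Type*} [SMul ℝ E] (γ : ℝ) (A : E → Set E) : E → Set E :=
  fun x => (γ • ·) '' A x

/-- `x = J_{γ A}(w)`, i.e. `w ∈ x + γ A x`. -/
def IsRes {E : Type*} [AddCommGroup E] [Module ℝ E] (γ : ℝ) (A : E → Set E) (w x : E) : Prop :=
  w - x ∈ smulOp γ A x

/-- weak convergence in a Hilbert space -/
def WConv {E : Type*} [NormedAddCommGroup E] [InnerProductSpace ℝ E] (u : ℕ → E) (l : E) : Prop :=
  ∀ w : E, Tendsto (fun n => ⟪u n, w⟫) atTop (𝓝 ⟪l, w⟫)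

/-- Nonnegative real sequences with `a (n + 1) ≤ a n + e n`, `e` summable, converge. -/
theorem exists_tendsto_of_le_add_summable {a e : ℕ → ℝ} (ha : ∀ n, 0 ≤ a n)
    (he : Summable e) (h : ∀ n, a (n + 1) ≤ a n + e n) :
    ∃ l, Tendsto a atTop (𝓝 l) := by
  have hs := he.hasSum.tendsto_sum_nat
  obtain ⟨B, hB⟩ := hs.bddAbove_range
  have hanti : Antitone fun n => a n - ∑ k ∈ Finset.range n, e k := by
    refine antitone_nat_of_succ_le fun n => ?_
    rw [Finset.sum_range_succ]
    linarith [h n]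
  have hbdd : BddBelow (Set.range fun n => a n - ∑ k ∈ Finset.range n, e k) := by
    refine ⟨-B, ?_⟩
    rintro _ ⟨n, rfl⟩
    have := hB ⟨n, rfl⟩
    simp only at this ⊢
    linarith [ha n]
  have ht := (tendsto_atTop_ciInf hanti hbdd).add hs
  exact ⟨_, ht.congr fun n => by ring⟩

/-- Convergence of perturbed Fejér-monotone real sequences; the decrements vanish. -/
theorem exists_tendsto_and_tendsto_zero_of_fejer {a b e δ : ℕ → ℝ} (ha : ∀ n, 0 ≤ a n)
    (hδ : ∀ n, 0 ≤ δ n) (he0 : ∀ n, 0 ≤ e n) (he : Summable e)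
    (h : ∀ n, a (n + 1) ≤ b n + e n) (hdec : ∀ n, b n ^ 2 + δ n ≤ a n ^ 2) :
    (∃ l, Tendsto a atTop (𝓝 l)) ∧ Tendsto δ atTop (𝓝 0) := by
  have hba : ∀ n, b n ≤ a n := fun n =>
    le_of_sq_le_sq (by linarith [hdec n, hδ n]) (ha n)
  obtain ⟨l, hl⟩ := exists_tendsto_of_le_add_summable ha he
    fun n => (h n).trans (by linarith [hba n])
  refine ⟨⟨l, hl⟩, ?_⟩
  have he' := he.tendsto_atTop_zero
  have hlim : Tendsto (fun n => a n ^ 2 - a (n + 1) ^ 2 + 2 * (e n * a n) + e n ^ 2) atTop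
      (𝓝 (l ^ 2 - l ^ 2 + 2 * (0 * l) + 0 ^ 2)) :=
    (((hl.pow 2).sub (((tendsto_add_atTop_iff_nat 1).2 hl).pow 2)).add
      ((he'.mul hl).const_mul 2)).add (he'.pow 2)
  have hz : l ^ 2 - l ^ 2 + 2 * (0 * l) + 0 ^ 2 = 0 := by ring
  rw [hz] at hlim
  refine squeeze_zero hδ (fun n => ?_) hlim
  have h1 : a (n + 1) ^ 2 ≤ (b n + e n) ^ 2 := pow_le_pow_left₀ (ha _) (h n) 2
  nlinarith [hdec n, mul_le_mul_of_nonneg_left (hba n) (he0 n)]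

section Hilbert

variable {W : Type*} [NormedAddCommGroup W] [InnerProductSpace ℝ W]

/-- A bounded sequence in a Hilbert space converges weakly along every ultrafilter. -/
theorem Ultrafilter.exists_tendsto_inner_of_norm_le [CompleteSpace W] {w : ℕ → W} {R : ℝ}
    (hR : ∀ n, ‖w n‖ ≤ R) (U : Ultrafilter ℕ) :
    ∃ l : W, ∀ y, Tendsto (fun n => ⟪w n, y⟫) U (𝓝 ⟪l, y⟫) := by
  let f : ℕ → WeakDual ℝ W := fun n =>
    StrongDual.toWeakDual (InnerProductSpace.toDual ℝ W (w n))
  have hc := WeakDual.isCompact_closedBall (𝕜 := ℝ) (0 : StrongDual ℝ W) R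
  have hmem : (U.map f : Filter (WeakDual ℝ W)) ≤
      𝓟 (WeakDual.toStrongDual ⁻¹' Metric.closedBall (0 : StrongDual ℝ W) R) := by
    rw [Filter.le_principal_iff]
    refine Filter.mem_map.2 (Filter.univ_mem' fun n => ?_)
    simp only [Set.mem_preimage, mem_closedBall_zero_iff, f]
    exact (LinearIsometryEquiv.norm_map (InnerProductSpace.toDual ℝ W) (w n)).trans_le (hR n)
  obtain ⟨g, -, hg⟩ := hc.ultrafilter_le_nhds _ hmem
  refine ⟨(InnerProductSpace.toDual ℝ W).symm (WeakDual.toStrongDual g), fun y => ?_⟩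
  rw [InnerProductSpace.toDual_symm_apply]
  exact ((WeakDual.eval_continuous y).tendsto g).comp (show Tendsto f U (𝓝 g) from hg)

theorem tendsto_inner_of_weak_of_strong {F : Filter ℕ} {w v : ℕ → W} {l v₀ : W} {R : ℝ}
    (hR : ∀ n, ‖w n‖ ≤ R) (hw : ∀ y, Tendsto (fun n => ⟪w n, y⟫) F (𝓝 ⟪l, y⟫))
    (hv : Tendsto v F (𝓝 v₀)) : Tendsto (fun n => ⟪w n, v n⟫) F (𝓝 ⟪l, v₀⟫) := by
  have h0 : Tendsto (fun n => ⟪w n, v n - v₀⟫) F (𝓝 0) := by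
    refine squeeze_zero_norm (fun n => ?_)
      (by simpa using (tendsto_iff_norm_sub_tendsto_zero.1 hv).const_mul R)
    exact (norm_inner_le_norm _ _).trans (mul_le_mul_of_nonneg_right (hR n) (norm_nonneg _))
  have := (hw v₀).add h0
  rw [add_zero] at this
  exact this.congr fun n => by rw [inner_sub_right]; ring

theorem LinearMap.IsSymmetric.inner_map_add_self {V : W →ₗ[ℝ] W} (hV : V.IsSymmetric) (a b : W) :
    ⟪V (a + b), a + b⟫ = ⟪V a, a⟫ + 2 * ⟪V a, b⟫ + ⟪V b, b⟫ := by
  have h : ⟪V b, a⟫ = ⟪V a, b⟫ := by rw [hV b a, real_inner_comm]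
  rw [map_add, inner_add_left, inner_add_right, inner_add_right, h]
  ring

theorem LinearMap.IsSymmetric.inner_map_smul_self {V : W →ₗ[ℝ] W} (t : ℝ) (a : W) :
    ⟪V (t • a), t • a⟫ = t ^ 2 * ⟪V a, a⟫ := by
  rw [map_smul, real_inner_smul_left, real_inner_smul_right]
  ring

/-- Triangle inequality for the seminorm induced by a positive symmetric operator. -/
theorem LinearMap.IsSymmetric.sqrt_inner_map_add_le {V : W →ₗ[ℝ] W} (hV : V.IsSymmetric)
    (hpos : ∀ a, 0 ≤ ⟪V a, a⟫) (a b : W) :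
    √⟪V (a + b), a + b⟫ ≤ √⟪V a, a⟫ + √⟪V b, b⟫ := by
  have hcs : ⟪V a, b⟫ ^ 2 ≤ ⟪V a, a⟫ * ⟪V b, b⟫ := by
    have h : ∀ t : ℝ, 0 ≤ ⟪V b, b⟫ * (t * t) + 2 * ⟪V a, b⟫ * t + ⟪V a, a⟫ := fun t => by
      have := hpos (a + t • b)
      rw [hV.inner_map_add_self, real_inner_smul_right,
        LinearMap.IsSymmetric.inner_map_smul_self] at this
      linarith
    have := discrim_le_zero h
    rw [discrim] at this
    nlinarith
  have hcs' : ⟪V a, b⟫ ≤ √⟪V a, a⟫ * √⟪V b, b⟫ := by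
    rw [← Real.sqrt_mul (hpos a)]
    exact Real.le_sqrt_of_sq_le hcs
  refine Real.sqrt_le_iff.2 ⟨by positivity, ?_⟩
  rw [hV.inner_map_add_self]
  nlinarith [Real.sq_sqrt (hpos a), Real.sq_sqrt (hpos b)]

/-- The decrease of the distance to a zero along one forward-backward step. -/
theorem MonoOp.forward_backward_decrease {T : W → Set W} (hT : MonoOp T) {Q : W → W} {β κ : ℝ}
    (hβ : 0 < β) (hκ : 0 < κ) (hβκ : 1 < 2 * β * κ)
    (hQ : ∀ x y, β * ‖Q x - Q y‖ ^ 2 ≤ ⟪x - y, Q x - Q y⟫)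
    {V : W →ₗ[ℝ] W} (hV : V.IsSymmetric) (hVκ : ∀ a, κ * ‖a‖ ^ 2 ≤ ⟪V a, a⟫)
    {s w j : W} (hs : -Q s ∈ T s) (hj : V (w - j) - Q w ∈ T j) :
    ⟪V (j - s), j - s⟫ + (2 * β * κ - 1) / (κ + 2 * β) * (‖w - j‖ ^ 2 + ‖Q w - Q s‖ ^ 2) ≤
      ⟪V (w - s), w - s⟫ := by
  have hmono := hT hj hs
  have hsplit : w - s = (w - j) + (j - s) := by abel
  have h1 : ⟪V (w - s), w - s⟫ =
      ⟪V (w - j), w - j⟫ + 2 * ⟪V (w - j), j - s⟫ + ⟪V (j - s), j - s⟫ := by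
    conv_lhs => rw [hsplit]
    exact hV.inner_map_add_self _ _
  have h2 : V (w - j) - Q w - -Q s = V (w - j) - (Q w - Q s) := by abel
  rw [h2, inner_sub_right, real_inner_comm (V (w - j))] at hmono
  have h3 : ⟪j - s, Q w - Q s⟫ = ⟪w - s, Q w - Q s⟫ - ⟪w - j, Q w - Q s⟫ := by
    rw [← inner_sub_left]; congr 1; abel
  have h4 := hQ w s
  have h5 := real_inner_le_norm (w - j) (Q w - Q s)
  have h6 := hVκ (w - j)
  set c := (2 * β * κ - 1) / (κ + 2 * β) with hc
  have hc0 : c * (κ + 2 * β) = 2 * β * κ - 1 := by rw [hc]; field_simp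
  have hcκ : 0 < κ - c := by
    have : 0 < (κ - c) * (κ + 2 * β) := by nlinarith [sq_nonneg κ]
    exact pos_of_mul_pos_left this (by positivity)
  have hprod : (κ - c) * (2 * β - c) = 1 + c ^ 2 := by linear_combination -hc0
  have key : 2 * (‖w - j‖ * ‖Q w - Q s‖) ≤
      (κ - c) * ‖w - j‖ ^ 2 + (2 * β - c) * ‖Q w - Q s‖ ^ 2 := by
    set e := ‖w - j‖
    set d := ‖Q w - Q s‖
    have h7 : 0 ≤ ((κ - c) * e - d) ^ 2 + c ^ 2 * d ^ 2 := by positivity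
    have h8 : ((κ - c) * e - d) ^ 2 + c ^ 2 * d ^ 2 =
        (κ - c) * ((κ - c) * e ^ 2 + (2 * β - c) * d ^ 2 - 2 * (e * d)) := by
      linear_combination (-d ^ 2) * hprod
    rw [h8] at h7
    linarith [nonneg_of_mul_nonneg_right h7 hcκ]
  linarith

/-- Weak convergence of the relaxed inexact forward-backward iteration in the metric of a
strongly positive operator `V`. -/
theorem exists_wConv_of_forward_backward [CompleteSpace W] {T : W → Set W} (hT : MonoOp T)
    (hTmax : ∀ w u, (∀ a b, b ∈ T a → 0 ≤ ⟪w - a, u - b⟫) → u ∈ T w)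
    {Q : W → W} {β κ : ℝ} (hβ : 0 < β) (hκ : 0 < κ) (hβκ : 1 < 2 * β * κ)
    (hQ : ∀ x y, β * ‖Q x - Q y‖ ^ 2 ≤ ⟪x - y, Q x - Q y⟫)
    {V : W →ₗ[ℝ] W} (hV : V.IsSymmetric) (hVκ : ∀ a, κ * ‖a‖ ^ 2 ≤ ⟪V a, a⟫)
    (hzero : ∃ s, -Q s ∈ T s) {ε : ℝ} (hε : 0 < ε) {lam : ℕ → ℝ}
    (hlam : ∀ n, lam n ∈ Set.Icc ε 1) {w wt j : ℕ → W}
    (hj : ∀ n, V (w n - j n) - Q (w n) ∈ T (j n))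
    (hsum : Summable fun n => ‖wt n - j n‖)
    (hw : ∀ n, w (n + 1) = w n + lam n • (wt n - w n)) :
    ∃ s, -Q s ∈ T s ∧ WConv w s := by
  have hVc : Continuous V := hV.continuous
  have hpos : ∀ a, 0 ≤ ⟪V a, a⟫ := fun a => (by positivity : 0 ≤ κ * ‖a‖ ^ 2).trans (hVκ a)
  set c := (2 * β * κ - 1) / (κ + 2 * β) with hc
  have hc0 : 0 < c := div_pos (by linarith) (by positivity)
  obtain ⟨N, hN0, hN⟩ : ∃ N, 0 ≤ N ∧ ∀ a, √⟪V a, a⟫ ≤ N * ‖a‖ := by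
    let V' : W →L[ℝ] W := ⟨V, hVc⟩
    refine ⟨√‖V'‖, by positivity, fun a => Real.sqrt_le_iff.2 ⟨by positivity, ?_⟩⟩
    rw [mul_pow, Real.sq_sqrt (norm_nonneg _)]
    have h1 := real_inner_le_norm (V a) a
    have h2 : ‖V a‖ ≤ ‖V'‖ * ‖a‖ := V'.le_opNorm a
    nlinarith [norm_nonneg a]
  have main : ∀ s, -Q s ∈ T s →
      (∃ l, Tendsto (fun n => √⟪V (w n - s), w n - s⟫) atTop (𝓝 l)) ∧
      Tendsto (fun n => ε * (c * (‖w n - j n‖ ^ 2 + ‖Q (w n) - Q s‖ ^ 2))) atTop (𝓝 0) := by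
    intro s hs
    refine exists_tendsto_and_tendsto_zero_of_fejer
      (b := fun n => √⟪V ((w n - s) + lam n • (j n - w n)), (w n - s) + lam n • (j n - w n)⟫)
      (e := fun n => N * ‖wt n - j n‖)
      (fun n => Real.sqrt_nonneg _) (fun n => by positivity)
      (fun n => by positivity) (hsum.mul_left N) (fun n => ?_) (fun n => ?_)
    · have h1 : w (n + 1) - s =
          ((w n - s) + lam n • (j n - w n)) + lam n • (wt n - j n) := by
        rw [hw]; module
      rw [h1]
      refine (hV.sqrt_inner_map_add_le hpos _ _).trans (add_le_add_right ((hN _).trans ?_) _)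
      rw [norm_smul, Real.norm_of_nonneg (hε.le.trans (hlam n).1)]
      exact mul_le_mul_of_nonneg_left
        (mul_le_of_le_one_left (norm_nonneg _) (hlam n).2) hN0
    · rw [Real.sq_sqrt (hpos _), Real.sq_sqrt (hpos _)]
      have hdec := hT.forward_backward_decrease hβ hκ hβκ hQ hV hVκ hs (hj n)
      rw [← hc] at hdec
      have h1 := hV.inner_map_add_self (w n - s) (lam n • (j n - w n))
      rw [LinearMap.IsSymmetric.inner_map_smul_self, real_inner_smul_right] at h1
      have h2 := hV.inner_map_add_self (w n - s) (j n - w n)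
      rw [show w n - s + (j n - w n) = j n - s by abel] at h2
      have h3 := hpos (j n - w n)
      obtain ⟨hl, hl'⟩ := hlam n
      rw [h1]
      have h4 : 0 ≤ c * (‖w n - j n‖ ^ 2 + ‖Q (w n) - Q s‖ ^ 2) := by positivity
      nlinarith [mul_nonneg (mul_nonneg (hε.le.trans hl) (sub_nonneg.2 hl')) h3,
        mul_nonneg (sub_nonneg.2 hl) h4,
        mul_le_mul_of_nonneg_left hdec (hε.le.trans hl)]
  have zeros : ∀ s, -Q s ∈ T s → Tendsto (fun n => w n - j n) atTop (𝓝 0) ∧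
      Tendsto (fun n => Q (w n)) atTop (𝓝 (Q s)) := by
    intro s hs
    have h0 := (main s hs).2.const_mul (ε * c)⁻¹
    rw [mul_zero] at h0
    have h1 : Tendsto (fun n => ‖w n - j n‖ ^ 2 + ‖Q (w n) - Q s‖ ^ 2) atTop (𝓝 0) :=
      h0.congr fun n => by field_simp
    have aux : ∀ f : ℕ → W, (∀ n, ‖f n‖ ^ 2 ≤ ‖w n - j n‖ ^ 2 + ‖Q (w n) - Q s‖ ^ 2) →
        Tendsto f atTop (𝓝 0) := by
      intro f hf
      rw [tendsto_zero_iff_norm_tendsto_zero]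
      have := (squeeze_zero (fun n => sq_nonneg ‖f n‖) hf h1).sqrt
      simpa using this
    exact ⟨aux _ fun n => by nlinarith [sq_nonneg ‖Q (w n) - Q s‖],
      tendsto_sub_nhds_zero_iff.1 (aux _ fun n => by nlinarith [sq_nonneg ‖w n - j n‖])⟩
  obtain ⟨s₀, hs₀⟩ := hzero
  obtain ⟨hwj, hQw⟩ := zeros s₀ hs₀
  obtain ⟨R, hR⟩ : ∃ R, ∀ n, ‖w n‖ ≤ R := by
    obtain ⟨⟨l, hl⟩, -⟩ := main s₀ hs₀
    obtain ⟨R, hR⟩ := hl.bddAbove_range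
    refine ⟨R / √κ + ‖s₀‖, fun n => ?_⟩
    have h1 : √κ * ‖w n - s₀‖ ≤ R := by
      refine le_trans (Real.le_sqrt_of_sq_le ?_) (hR ⟨n, rfl⟩)
      rw [mul_pow, Real.sq_sqrt hκ.le]
      exact hVκ _
    have h2 : ‖w n - s₀‖ ≤ R / √κ := by
      rw [le_div_iff₀ (Real.sqrt_pos.2 hκ)]; linarith
    linarith [norm_le_norm_sub_add (w n) s₀]
  obtain ⟨R', hR'⟩ : ∃ R', ∀ n, ‖j n‖ ≤ R' := by
    obtain ⟨R', hR'⟩ := hwj.norm.bddAbove_range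
    refine ⟨R + R', fun n => ?_⟩
    have h1 : ‖w n - j n‖ ≤ R' := hR' ⟨n, rfl⟩
    have h2 := norm_sub_le (w n) (w n - j n)
    rw [sub_sub_cancel] at h2
    linarith [hR n]
  -- every weak cluster point along an ultrafilter is a zero
  have cluster : ∀ U : Ultrafilter ℕ, (U : Filter ℕ) ≤ atTop → ∀ l,
      (∀ y, Tendsto (fun n => ⟪w n, y⟫) U (𝓝 ⟪l, y⟫)) → -Q l ∈ T l := by
    intro U hU l hl
    have hQl : Q l = Q s₀ := by
      have h1 : Tendsto (fun n => ⟪w n, Q (w n) - Q l⟫ - ⟪l, Q (w n) - Q l⟫) U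
          (𝓝 (⟪l, Q s₀ - Q l⟫ - ⟪l, Q s₀ - Q l⟫)) := by
        have h2 := (hQw.mono_left hU).sub_const (Q l)
        exact (tendsto_inner_of_weak_of_strong hR hl h2).sub (tendsto_const_nhds.inner h2)
      have h3 : Tendsto (fun n => β * ‖Q (w n) - Q l‖ ^ 2) U (𝓝 (β * ‖Q s₀ - Q l‖ ^ 2)) :=
        ((((hQw.mono_left hU).sub_const (Q l)).norm).pow 2).const_mul β
      have h4 := le_of_tendsto_of_tendsto' h3 h1 fun n => by
        rw [← inner_sub_left]; exact hQ _ _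
      rw [sub_self] at h4
      have h5 : ‖Q s₀ - Q l‖ ^ 2 ≤ 0 := nonpos_of_mul_nonpos_right h4 hβ
      have h6 : ‖Q s₀ - Q l‖ = 0 := by nlinarith [norm_nonneg (Q s₀ - Q l)]
      exact (sub_eq_zero.1 (norm_eq_zero.1 h6)).symm
    have hjl : ∀ y, Tendsto (fun n => ⟪j n, y⟫) U (𝓝 ⟪l, y⟫) := by
      intro y
      have h1 : Tendsto (fun n => ⟪w n - j n, y⟫) U (𝓝 0) := by
        simpa using (hwj.mono_left hU).inner (tendsto_const_nhds (x := y))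
      have h2 := (hl y).sub h1
      rw [sub_zero] at h2
      exact h2.congr fun n => by rw [inner_sub_left]; ring
    refine hTmax _ _ fun a b hb => ?_
    have h1 : Tendsto (fun n => V (w n - j n) - Q (w n) - b) U (𝓝 (-Q l - b)) := by
      have h2 : Tendsto (fun n => V (w n - j n)) U (𝓝 0) := by
        rw [← map_zero V]
        exact (hVc.tendsto 0).comp (hwj.mono_left hU)
      have h3 := (h2.sub (hQw.mono_left hU)).sub_const b
      rwa [zero_sub, ← hQl] at h3
    have h4 : Tendsto (fun n => ⟪j n, V (w n - j n) - Q (w n) - b⟫ -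
        ⟪a, V (w n - j n) - Q (w n) - b⟫) U (𝓝 (⟪l, -Q l - b⟫ - ⟪a, -Q l - b⟫)) :=
      (tendsto_inner_of_weak_of_strong hR' hjl h1).sub (tendsto_const_nhds.inner h1)
    rw [inner_sub_left]
    refine ge_of_tendsto' h4 fun n => ?_
    rw [← inner_sub_left]
    exact hT (hj n) hb
  -- weak cluster points are unique
  have unique : ∀ U U' : Ultrafilter ℕ, (U : Filter ℕ) ≤ atTop → (U' : Filter ℕ) ≤ atTop →
      ∀ l l', (∀ y, Tendsto (fun n => ⟪w n, y⟫) U (𝓝 ⟪l, y⟫)) →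
      (∀ y, Tendsto (fun n => ⟪w n, y⟫) U' (𝓝 ⟪l', y⟫)) → l = l' := by
    intro U U' hU hU' l l' hl hl'
    obtain ⟨⟨a, ha⟩, -⟩ := main l (cluster U hU l hl)
    obtain ⟨⟨a', ha'⟩, -⟩ := main l' (cluster U' hU' l' hl')
    have h1 : Tendsto (fun n => ⟪w n, V (l' - l)⟫) atTop
        (𝓝 ((a ^ 2 - a' ^ 2 - ⟪V l, l⟫ + ⟪V l', l'⟫) / 2)) := by
      refine ((((ha.pow 2).sub (ha'.pow 2)).sub_const ⟪V l, l⟫).add_const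
        ⟪V l', l'⟫).div_const 2 |>.congr fun n => ?_
      have e : ∀ t, ⟪V (w n - t), w n - t⟫ = ⟪V (w n), w n⟫ - 2 * ⟪w n, V t⟫ + ⟪V t, t⟫ := by
        intro t
        rw [map_sub, inner_sub_left, inner_sub_right, inner_sub_right, hV (w n) t,
          real_inner_comm (w n) (V t)]
        ring
      rw [Real.sq_sqrt (hpos _), Real.sq_sqrt (hpos _), e, e, map_sub, inner_sub_right]
      ring
    have h2 := tendsto_nhds_unique (hl (V (l' - l))) (h1.mono_left hU)
    have h3 := tendsto_nhds_unique (hl' (V (l' - l))) (h1.mono_left hU')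
    have h4 : ⟪V (l' - l), l' - l⟫ = 0 := by
      rw [real_inner_comm, inner_sub_left, h2, h3, sub_self]
    have h5 := hVκ (l' - l)
    rw [h4] at h5
    have h6 : ‖l' - l‖ ^ 2 ≤ 0 := nonpos_of_mul_nonpos_right h5 hκ
    have h7 : ‖l' - l‖ = 0 := by nlinarith [norm_nonneg (l' - l)]
    exact (sub_eq_zero.1 (norm_eq_zero.1 h7)).symm
  obtain ⟨U₀, hU₀⟩ := Ultrafilter.exists_le (atTop : Filter ℕ)
  obtain ⟨s, hs⟩ := Ultrafilter.exists_tendsto_inner_of_norm_le hR U₀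
  refine ⟨s, cluster U₀ hU₀ s hs, fun y => ?_⟩
  rw [tendsto_iff_ultrafilter]
  intro U hU
  obtain ⟨l, hl⟩ := Ultrafilter.exists_tendsto_inner_of_norm_le hR U
  rw [unique U₀ U hU₀ hU s l hs hl]
  exact hl y

end Hilbert

section Operators

variable {E F : Type*} [NormedAddCommGroup E] [InnerProductSpace ℝ E]
  [NormedAddCommGroup F] [InnerProductSpace ℝ F]

/-- Monotone operators containing every pair monotonically related to their graph. -/
def GraphMaximal (T : E → Set E) : Prop :=
  ∀ w u, (∀ a b, b ∈ T a → (0 : ℝ) ≤ ⟪w - a, u - b⟫) → u ∈ T w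

theorem MaxMonoOp.graphMaximal {T : E → Set E} (hT : MaxMonoOp T) : GraphMaximal T := by
  intro w u h
  let T' : E → Set E := fun a => {b | b ∈ T a ∨ (a = w ∧ b = u)}
  have hmono : MonoOp T' := by
    rintro a a' b b' (hb | ⟨rfl, rfl⟩) (hb' | ⟨rfl, rfl⟩)
    · exact hT.1 hb hb'
    · have := h a b hb
      rwa [← neg_sub a, ← neg_sub b, inner_neg_neg] at this
    · exact h a' b' hb'
    · simp
  rw [← hT.2 T' hmono fun a b hb => Or.inl hb]
  exact Or.inr ⟨rfl, rfl⟩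

theorem MonoOp.invOp {T : E → Set E} (hT : MonoOp T) : MonoOp (invOp T) := by
  intro a a' b b' hb hb'
  rw [real_inner_comm]
  exact hT hb hb'

theorem GraphMaximal.invOp {T : E → Set E} (hT : GraphMaximal T) : GraphMaximal (invOp T) := by
  intro w u h
  refine hT u w fun a b hb => ?_
  rw [real_inner_comm]
  exact h b a hb

theorem GraphMaximal.exists_inner_nonpos {T : E → Set E} (hT : GraphMaximal T) (w u : E) :
    ∃ a b, b ∈ T a ∧ ⟪w - a, u - b⟫ ≤ 0 ∧ (u ∉ T w → ⟪w - a, u - b⟫ < 0) := by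
  by_cases hu : u ∈ T w
  · exact ⟨w, u, hu, by simp, fun h => absurd hu h⟩
  · have h := mt (hT w u) hu
    push Not at h
    obtain ⟨a, b, hb, hlt⟩ := h
    exact ⟨a, b, hb, hlt.le, fun _ => hlt⟩

/-- The operator with constant value `c`. -/
def constOp (c : E) : E → Set E := fun _ => {c}

theorem monoOp_constOp (c : E) : MonoOp (constOp c) := by
  rintro a a' b b' rfl rfl
  simp

theorem graphMaximal_constOp (c : E) : GraphMaximal (constOp c) := by
  intro w u h
  have := h (w + (u - c)) c rfl
  rw [sub_add_cancel_left, inner_neg_left, real_inner_self_eq_norm_sq] at this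
  have h0 : ‖u - c‖ = 0 := by nlinarith [norm_nonneg (u - c)]
  exact sub_eq_zero.1 (norm_eq_zero.1 h0)

/-- The operator `w ↦ T w + S w` for single-valued `S`. -/
def addMapOp (T : E → Set E) (S : E → E) : E → Set E := fun w => {u | u - S w ∈ T w}

theorem inner_sub_sub_of_skew {S : E → E} (hS : ∀ a b, ⟪a - b, S a - S b⟫ = (0 : ℝ))
    (a b u v : E) : ⟪a - b, (u - S a) - (v - S b)⟫ = ⟪a - b, u - v⟫ := by
  rw [sub_sub_sub_comm, inner_sub_right, hS, sub_zero]

theorem MonoOp.addMapOp {T : E → Set E} (hT : MonoOp T) {S : E → E}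
    (hS : ∀ a b, ⟪a - b, S a - S b⟫ = (0 : ℝ)) : MonoOp (addMapOp T S) := by
  intro a b u v hu hv
  rw [← inner_sub_sub_of_skew hS]
  exact hT hu hv

theorem GraphMaximal.addMapOp {T : E → Set E} (hT : GraphMaximal T) {S : E → E}
    (hS : ∀ a b, ⟪a - b, S a - S b⟫ = (0 : ℝ)) : GraphMaximal (addMapOp T S) := by
  intro w u h
  refine hT w _ fun a b hb => ?_
  have := h a (b + S a) (by simpa [_root_.addMapOp] using hb)
  rwa [← inner_sub_sub_of_skew hS, add_sub_cancel_right] at this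

/-- Cartesian product of two set-valued operators. -/
def prodOp (T : E → Set E) (T' : F → Set F) : WithLp 2 (E × F) → Set (WithLp 2 (E × F)) :=
  fun w => {u | u.fst ∈ T w.fst ∧ u.snd ∈ T' w.snd}

theorem MonoOp.prodOp {T : E → Set E} {T' : F → Set F} (hT : MonoOp T) (hT' : MonoOp T') :
    MonoOp (prodOp T T') := by
  intro a b u v hu hv
  exact add_nonneg (hT hu.1 hv.1) (hT' hu.2 hv.2)

theorem GraphMaximal.prodOp {T : E → Set E} {T' : F → Set F} (hT : GraphMaximal T)
    (hT' : GraphMaximal T') : GraphMaximal (prodOp T T') := by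
  intro w u h
  obtain ⟨a, b, hb, hle, hlt⟩ := hT.exists_inner_nonpos w.fst u.fst
  obtain ⟨a', b', hb', hle', hlt'⟩ := hT'.exists_inner_nonpos w.snd u.snd
  have key : (0 : ℝ) ≤ ⟪w.fst - a, u.fst - b⟫ + ⟪w.snd - a', u.snd - b'⟫ :=
    h (WithLp.toLp 2 (a, a')) (WithLp.toLp 2 (b, b')) ⟨hb, hb'⟩
  constructor
  · by_contra hu
    linarith [hlt hu]
  · by_contra hu
    linarith [hlt' hu]

variable {ι : Type*} [Fintype ι] {P : ι → Type*} [∀ i, NormedAddCommGroup (P i)]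
  [∀ i, InnerProductSpace ℝ (P i)]

/-- Cartesian product of a finite family of set-valued operators. -/
def piOp (T : ∀ i, P i → Set (P i)) : PiLp 2 P → Set (PiLp 2 P) :=
  fun w => {u | ∀ i, u i ∈ T i (w i)}

theorem monoOp_piOp {T : ∀ i, P i → Set (P i)} (hT : ∀ i, MonoOp (T i)) : MonoOp (piOp T) := by
  intro a b u v hu hv
  exact Finset.sum_nonneg fun i _ => hT i (hu i) (hv i)

theorem graphMaximal_piOp {T : ∀ i, P i → Set (P i)} (hT : ∀ i, GraphMaximal (T i)) :
    GraphMaximal (piOp T) := by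
  intro w u h i
  by_contra hu
  choose a b hb hle hlt using fun i => (hT i).exists_inner_nonpos (w i) (u i)
  have key : (0 : ℝ) ≤ ∑ i, ⟪w i - a i, u i - b i⟫ := h (WithLp.toLp 2 a) (WithLp.toLp 2 b) hb
  have : ∑ i, ⟪w i - a i, u i - b i⟫ < (0 : ℝ) :=
    Finset.sum_neg' (fun i _ => hle i) ⟨i, Finset.mem_univ i, hlt i hu⟩
  linarith

theorem WConv.map [CompleteSpace E] [CompleteSpace F] {w : ℕ → E} {l : E} (h : WConv w l)
    (Φ : E →L[ℝ] F) : WConv (fun n => Φ (w n)) (Φ l) := by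
  intro y
  simp_rw [← ContinuousLinearMap.adjoint_inner_right]
  exact h _

end Operators

section SummableNorm

variable {E F : Type*} [NormedAddCommGroup E] [NormedAddCommGroup F]

theorem Summable.norm_add {f g : ℕ → E} (hf : Summable fun n => ‖f n‖)
    (hg : Summable fun n => ‖g n‖) : Summable fun n => ‖f n + g n‖ :=
  .of_nonneg_of_le (fun _ => norm_nonneg _) (fun _ => norm_add_le _ _) (hf.add hg)

theorem Summable.norm_sub {f g : ℕ → E} (hf : Summable fun n => ‖f n‖)
    (hg : Summable fun n => ‖g n‖) : Summable fun n => ‖f n - g n‖ :=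
  .of_nonneg_of_le (fun _ => norm_nonneg _) (fun _ => norm_sub_le _ _) (hf.add hg)

theorem Summable.norm_toLp_prod {f : ℕ → E} {g : ℕ → F} (hf : Summable fun n => ‖f n‖)
    (hg : Summable fun n => ‖g n‖) : Summable fun n => ‖WithLp.toLp 2 (f n, g n)‖ := by
  refine .of_nonneg_of_le (fun _ => norm_nonneg _) (fun n => ?_) (hf.add hg)
  refine le_of_sq_le_sq ?_ (by positivity)
  rw [WithLp.prod_norm_sq_eq_of_L2]
  simp only [WithLp.toLp_fst, WithLp.toLp_snd]
  nlinarith [norm_nonneg (f n), norm_nonneg (g n)]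

theorem summable_norm_toLp_pi {ι : Type*} [Fintype ι] {P : ι → Type*}
    [∀ i, NormedAddCommGroup (P i)] {f : ℕ → ∀ i, P i}
    (hf : ∀ i, Summable fun n => ‖f n i‖) :
    Summable fun n => ‖(WithLp.toLp 2 (f n) : PiLp 2 P)‖ := by
  refine .of_nonneg_of_le (fun _ => norm_nonneg _) (fun n => ?_)
    (summable_sum fun i (_ : i ∈ Finset.univ) => hf i)
  refine le_of_sq_le_sq ?_ (by positivity)
  rw [PiLp.norm_sq_eq_of_L2]
  exact Finset.sum_sq_le_sq_sum_of_nonneg fun i _ => norm_nonneg _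

variable [NormedSpace ℝ E] [NormedSpace ℝ F]

theorem Summable.norm_const_smul {f : ℕ → E} (hf : Summable fun n => ‖f n‖) (c : ℝ) :
    Summable fun n => ‖c • f n‖ := by
  simp_rw [norm_smul]
  exact hf.mul_left _

theorem Summable.norm_clm_apply {f : ℕ → E} (hf : Summable fun n => ‖f n‖) (Φ : E →L[ℝ] F) :
    Summable fun n => ‖Φ (f n)‖ :=
  .of_nonneg_of_le (fun _ => norm_nonneg _) (fun _ => Φ.le_opNorm _) (hf.mul_left _)

end SummableNorm

section Metric

variable {E F : Type*} [NormedAddCommGroup E] [InnerProductSpace ℝ E]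
  [NormedAddCommGroup F] [InnerProductSpace ℝ F]

theorem two_mul_le_of_sq_le {N P R s α : ℝ} (hs : 0 ≤ s) (hR : 0 ≤ R) (hα : 0 ≤ α)
    (hP : P ≤ α ^ 2) (hN : N ^ 2 ≤ P * (s * R)) : 2 * N ≤ α * (s + R) := by
  refine le_of_sq_le_sq ?_ (by positivity)
  have h1 : P * (s * R) ≤ α ^ 2 * (s * R) := mul_le_mul_of_nonneg_right hP (by positivity)
  nlinarith [mul_nonneg (sq_nonneg α) (sq_nonneg (s - R))]

theorem abs_inner_apply_le {K : E →L[ℝ] F} {θ γ α : ℝ} (hθ : 0 < θ) (hγ : 0 < γ)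
    (hα : √(θ * γ * ‖K‖ ^ 2) ≤ α) (z : E) (p : F) :
    2 * |⟪K z, p⟫| ≤ α * (θ⁻¹ * ‖p‖ ^ 2 + γ⁻¹ * ‖z‖ ^ 2) := by
  have hα0 : 0 ≤ α := (Real.sqrt_nonneg _).trans hα
  refine two_mul_le_of_sq_le (by positivity) (by positivity) hα0 (Real.sqrt_le_left hα0 |>.1 hα) ?_
  have h1 : |⟪K z, p⟫| ≤ ‖K‖ * ‖z‖ * ‖p‖ :=
    (abs_real_inner_le_norm _ _).trans
      (mul_le_mul_of_nonneg_right (K.le_opNorm z) (norm_nonneg _))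
  refine (pow_le_pow_left₀ (abs_nonneg _) h1 2).trans_eq ?_
  field_simp

theorem abs_sum_inner_apply_le {ι : Type*} [Fintype ι] {P : ι → Type*}
    [∀ i, NormedAddCommGroup (P i)] [∀ i, InnerProductSpace ℝ (P i)] {L : ∀ i, E →L[ℝ] P i}
    {τ α : ℝ} {σ : ι → ℝ} (hτ : 0 < τ) (hσ : ∀ i, 0 < σ i)
    (hα : √(τ * ∑ i, σ i * ‖L i‖ ^ 2) ≤ α) (x : E) (v : ∀ i, P i) :
    2 * |∑ i, ⟪v i, L i x⟫| ≤ α * (τ⁻¹ * ‖x‖ ^ 2 + ∑ i, (σ i)⁻¹ * ‖v i‖ ^ 2) := by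
  have hα0 : 0 ≤ α := (Real.sqrt_nonneg _).trans hα
  have hσ' : ∀ i, 0 < (σ i)⁻¹ := fun i => inv_pos.2 (hσ i)
  refine two_mul_le_of_sq_le (by positivity)
    (Finset.sum_nonneg fun i _ => mul_nonneg (hσ' i).le (sq_nonneg _)) hα0
    (Real.sqrt_le_left hα0 |>.1 hα) ?_
  have h1 : |∑ i, ⟪v i, L i x⟫| ≤ ‖x‖ * ∑ i, ‖L i‖ * ‖v i‖ := by
    rw [Finset.mul_sum]
    refine (Finset.abs_sum_le_sum_abs _ _).trans (Finset.sum_le_sum fun i _ => ?_)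
    refine (abs_real_inner_le_norm _ _).trans ?_
    nlinarith [mul_le_mul_of_nonneg_left ((L i).le_opNorm x) (norm_nonneg (v i))]
  have h2 : (∑ i, ‖L i‖ * ‖v i‖) ^ 2 ≤
      (∑ i, σ i * ‖L i‖ ^ 2) * ∑ i, (σ i)⁻¹ * ‖v i‖ ^ 2 :=
    Finset.sum_sq_le_sum_mul_sum_of_sq_le_mul _
      (fun i _ => mul_nonneg (hσ i).le (sq_nonneg _))
      (fun i _ => mul_nonneg (hσ' i).le (sq_nonneg _)) fun i _ => by
        have := (hσ i).ne'
        apply le_of_eq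
        field_simp
  refine (pow_le_pow_left₀ (abs_nonneg _) h1 2).trans ?_
  rw [mul_pow]
  refine (mul_le_mul_of_nonneg_left h2 (sq_nonneg ‖x‖)).trans_eq ?_
  field_simp

/-- An everywhere defined symmetric map is linear. -/
def LinearMap.ofSymmetric (V : E → E) (hV : ∀ a b, ⟪V a, b⟫ = (⟪a, V b⟫ : ℝ)) : E →ₗ[ℝ] E where
  toFun := V
  map_add' a b := ext_inner_right ℝ fun c => by
    rw [hV, inner_add_left, inner_add_left, hV, hV]
  map_smul' t a := ext_inner_right ℝ fun c => by
    rw [hV, RingHom.id_apply, real_inner_smul_left, real_inner_smul_left, hV]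

theorem inner_sub_sub_eq_zero_of_skew {S : E → E} (hS : ∀ a b, ⟪S a, b⟫ = -(⟪a, S b⟫ : ℝ))
    (a b : E) : ⟪a - b, S a - S b⟫ = (0 : ℝ) := by
  have h1 := hS a a
  have h2 := hS b b
  have h3 := hS a b
  rw [real_inner_comm] at h1 h2 h3
  rw [inner_sub_left, inner_sub_right, inner_sub_right]
  linarith

end Metric

section Resolvent

variable {E : Type*} [AddCommGroup E] [Module ℝ E]

theorem IsRes.inv_smul_mem {γ : ℝ} (hγ : 0 < γ) {A : E → Set E} {w x : E} (h : IsRes γ A w x) :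
    γ⁻¹ • (w - x) ∈ A x := by
  obtain ⟨u, hu, hux⟩ := h
  rw [← hux]
  simpa [smul_smul, inv_mul_cancel₀ hγ.ne'] using hu

/-- Solution of the linear system defining the backward step in the variables `z` and `y`. -/
theorem backward_step_linear_system {σ γ₁ γ₂ : ℝ}
    (hσ : 0 < σ) (hγ₁ : 0 < γ₁) (hγ₂ : 0 < γ₂) {u₁ u₂ z y : E}
    (hz : z = ((1 + σ * γ₂) / (1 + σ * (γ₁ + γ₂))) • (u₁ - (σ * γ₁ / (1 + σ * γ₂)) • u₂))
    (hy : y = (1 / (1 + σ * γ₂)) • (u₂ - (σ * γ₂) • z)) :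
    z = u₁ - (γ₁ * σ) • (z + y) ∧ y = u₂ - (γ₂ * σ) • (z + y) := by
  have h1 : 1 + σ * γ₂ ≠ 0 := by positivity
  have h2 : 1 + σ * (γ₁ + γ₂) ≠ 0 := by positivity
  subst hy
  constructor
  · subst hz
    match_scalars <;> field_simp <;> ring
  · match_scalars <;> field_simp <;> ring

theorem inv_smul_sub_add_sub_eq {γ : ℝ} (hγ : 0 < γ) {z z' a b s : E}
    (hz : z' = z + γ • (a - (2 : ℝ) • b + s)) :
    γ⁻¹ • (z - z') + (a - b) = b - s := by
  have := hγ.ne'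
  subst hz
  match_scalars <;> field_simp <;> ring

end Resolvent

section DualStep

variable {E : Type*} [NormedAddCommGroup E] [NormedSpace ℝ E]

/-- The perturbed dual updates stay within a summable distance of exact dual updates. -/
theorem exists_exact_dual_step {σ γ₁ γ₂ : ℝ} (hσ : 0 < σ) (hγ₁ : 0 < γ₁) (hγ₂ : 0 < γ₂)
    {z y v u₁ u₂ zt yt vt g g' a₁ a₁' a₂ a₂' : ℕ → E}
    (hg : Summable fun n => ‖g n - g' n‖) (ha₁ : Summable fun n => ‖a₁ n - a₁' n‖)
    (ha₂ : Summable fun n => ‖a₂ n - a₂' n‖)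
    (hu₁ : Summable fun n => ‖u₁ n - (z n + γ₁ • (a₁ n + v n + σ • g n))‖)
    (hu₂ : Summable fun n => ‖u₂ n - (y n + γ₂ • (a₂ n + v n + σ • g n))‖)
    (hzt : Summable fun n => ‖zt n - ((1 + σ * γ₂) / (1 + σ * (γ₁ + γ₂))) •
      (u₁ n - (σ * γ₁ / (1 + σ * γ₂)) • u₂ n)‖)
    (hyt : Summable fun n => ‖yt n - (1 / (1 + σ * γ₂)) • (u₂ n - (σ * γ₂) • zt n)‖)
    (hvt : Summable fun n => ‖vt n - (v n + σ • (g n - zt n - yt n))‖) :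
    ∃ jz jy jv : ℕ → E,
      (∀ n, jz n = z n + γ₁ • (a₁' n + jv n)) ∧ (∀ n, jy n = y n + γ₂ • (a₂' n + jv n)) ∧
      (∀ n, jv n = v n + σ • (g' n - (jz n + jy n))) ∧
      (Summable fun n => ‖zt n - jz n‖) ∧ (Summable fun n => ‖yt n - jy n‖) ∧
      Summable fun n => ‖vt n - jv n‖ := by
  obtain ⟨e₁, he₁⟩ : ∃ e : ℕ → E, ∀ n, e n = z n + γ₁ • (a₁' n + v n + σ • g' n) :=
    ⟨_, fun _ => rfl⟩
  obtain ⟨e₂, he₂⟩ : ∃ e : ℕ → E, ∀ n, e n = y n + γ₂ • (a₂' n + v n + σ • g' n) :=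
    ⟨_, fun _ => rfl⟩
  obtain ⟨jz, hjz⟩ : ∃ j : ℕ → E, ∀ n, j n = ((1 + σ * γ₂) / (1 + σ * (γ₁ + γ₂))) •
      (e₁ n - (σ * γ₁ / (1 + σ * γ₂)) • e₂ n) := ⟨_, fun _ => rfl⟩
  obtain ⟨jy, hjy⟩ : ∃ j : ℕ → E, ∀ n, j n = (1 / (1 + σ * γ₂)) • (e₂ n - (σ * γ₂) • jz n) :=
    ⟨_, fun _ => rfl⟩
  have hlin := fun n => backward_step_linear_system hσ hγ₁ hγ₂ (hjz n) (hjy n)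
  have hue₁ : Summable fun n => ‖u₁ n - e₁ n‖ :=
    (hu₁.norm_add ((ha₁.norm_add (hg.norm_const_smul σ)).norm_const_smul γ₁)).congr fun n => by
      congr 1
      rw [he₁]
      module
  have hue₂ : Summable fun n => ‖u₂ n - e₂ n‖ :=
    (hu₂.norm_add ((ha₂.norm_add (hg.norm_const_smul σ)).norm_const_smul γ₂)).congr fun n => by
      congr 1
      rw [he₂]
      module
  have hz : Summable fun n => ‖zt n - jz n‖ :=
    (hzt.norm_add ((hue₁.norm_sub (hue₂.norm_const_smul (σ * γ₁ / (1 + σ * γ₂)))).norm_const_smul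
      ((1 + σ * γ₂) / (1 + σ * (γ₁ + γ₂))))).congr fun n => by
      congr 1
      rw [hjz]
      module
  have hy : Summable fun n => ‖yt n - jy n‖ :=
    (hyt.norm_add ((hue₂.norm_sub (hz.norm_const_smul (σ * γ₂))).norm_const_smul
      (1 / (1 + σ * γ₂)))).congr fun n => by
      congr 1
      rw [hjy]
      module
  refine ⟨jz, jy, fun n => v n + σ • (g' n - (jz n + jy n)), fun n => ?_, fun n => ?_,
    fun n => rfl, hz, hy, ?_⟩
  · refine (hlin n).1.trans ?_
    rw [he₁]
    module
  · refine (hlin n).2.trans ?_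
    rw [he₂]
    module
  · refine (hvt.norm_add ((hg.norm_sub (hz.norm_add hy)).norm_const_smul σ)).congr fun n => ?_
    congr 1
    module

end DualStep

section PrimalDual

/-- The product space of the variables `(p, q, z, y, v)` attached to one index. -/
abbrev DualBlock (X Y G : Type*) := WithLp 2 (X × WithLp 2 (Y × WithLp 2 (G × WithLp 2 (G × G))))

namespace DualBlock

variable {X Y G : Type*}

abbrev mk (p : X) (q : Y) (z y v : G) : DualBlock X Y G :=
  WithLp.toLp 2 (p, WithLp.toLp 2 (q, WithLp.toLp 2 (z, WithLp.toLp 2 (y, v))))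

abbrev p (e : DualBlock X Y G) : X := e.fst
abbrev q (e : DualBlock X Y G) : Y := e.snd.fst
abbrev z (e : DualBlock X Y G) : G := e.snd.snd.fst
abbrev y (e : DualBlock X Y G) : G := e.snd.snd.snd.fst
abbrev v (e : DualBlock X Y G) : G := e.snd.snd.snd.snd

theorem q_mk (p : X) (q : Y) (z y v : G) : (mk p q z y v).q = q := rfl

theorem z_mk (p : X) (q : Y) (z y v : G) : (mk p q z y v).z = z := rfl

theorem y_mk (p : X) (q : Y) (z y v : G) : (mk p q z y v).y = y := rfl

theorem v_mk (p : X) (q : Y) (z y v : G) : (mk p q z y v).v = v := rfl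

end DualBlock

/-- The product space of all primal and dual variables. -/
abbrev PrimalDualSpace {ι : Type*} (H : Type*) (X Y G : ι → Type*) :=
  WithLp 2 (H × PiLp 2 fun i => DualBlock (X i) (Y i) (G i))

variable {ι : Type*} [Fintype ι]
  {H : Type*} [NormedAddCommGroup H] [InnerProductSpace ℝ H] [CompleteSpace H]
  {G : ι → Type*} [∀ i, NormedAddCommGroup (G i)] [∀ i, InnerProductSpace ℝ (G i)]
  [∀ i, CompleteSpace (G i)]
  {X : ι → Type*} [∀ i, NormedAddCommGroup (X i)] [∀ i, InnerProductSpace ℝ (X i)]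
  [∀ i, CompleteSpace (X i)]
  {Y : ι → Type*} [∀ i, NormedAddCommGroup (Y i)] [∀ i, InnerProductSpace ℝ (Y i)]
  [∀ i, CompleteSpace (Y i)]

/-- The point of the product space with the given coordinates. -/
abbrev PrimalDualSpace.mk (x : H) (p : ∀ i, X i) (q : ∀ i, Y i) (z y v : ∀ i, G i) :
    PrimalDualSpace H X Y G :=
  WithLp.toLp 2 (x, WithLp.toLp 2 fun i => DualBlock.mk (p i) (q i) (z i) (y i) (v i))

open ContinuousLinearMap (adjoint)

omit [CompleteSpace H] [∀ i, CompleteSpace (G i)] [∀ i, CompleteSpace (X i)]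
  [∀ i, CompleteSpace (Y i)] in
theorem PrimalDualSpace.inner_def (a b : PrimalDualSpace H X Y G) :
    (⟪a, b⟫ : ℝ) = ⟪a.fst, b.fst⟫ + ∑ i, (⟪(a.snd i).p, (b.snd i).p⟫ +
      (⟪(a.snd i).q, (b.snd i).q⟫ + (⟪(a.snd i).z, (b.snd i).z⟫ +
      (⟪(a.snd i).y, (b.snd i).y⟫ + ⟪(a.snd i).v, (b.snd i).v⟫)))) := rfl

/-- The skew coupling operator of the primal-dual system. -/
def skewMap (L : ∀ i, H →L[ℝ] G i) (K : ∀ i, G i →L[ℝ] X i) (M : ∀ i, G i →L[ℝ] Y i)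
    (w : PrimalDualSpace H X Y G) : PrimalDualSpace H X Y G :=
  PrimalDualSpace.mk (∑ i, adjoint (L i) (w.snd i).v)
    (fun i => -K i (w.snd i).z) (fun i => -M i (w.snd i).y)
    (fun i => adjoint (K i) (w.snd i).p - (w.snd i).v)
    (fun i => adjoint (M i) (w.snd i).q - (w.snd i).v)
    (fun i => (w.snd i).z + (w.snd i).y - L i w.fst)

theorem inner_skewMap (L : ∀ i, H →L[ℝ] G i) (K : ∀ i, G i →L[ℝ] X i) (M : ∀ i, G i →L[ℝ] Y i)
    (a b : PrimalDualSpace H X Y G) :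
    (⟪skewMap L K M a, b⟫ : ℝ) = -⟪a, skewMap L K M b⟫ := by
  rw [PrimalDualSpace.inner_def, PrimalDualSpace.inner_def]
  simp only [skewMap, PrimalDualSpace.mk, DualBlock.q_mk, DualBlock.z_mk,
    DualBlock.y_mk, DualBlock.v_mk, WithLp.toLp_fst, WithLp.toLp_snd, sum_inner, inner_sum,
    ContinuousLinearMap.adjoint_inner_left, ContinuousLinearMap.adjoint_inner_right,
    inner_neg_left, inner_neg_right, inner_sub_left, inner_sub_right, inner_add_left,
    inner_add_right]
  rw [← Finset.sum_add_distrib, ← Finset.sum_add_distrib, ← Finset.sum_neg_distrib]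
  exact Finset.sum_congr rfl fun i _ => by ring

/-- The metric operator of the primal-dual forward-backward iteration. -/
def metricMap (L : ∀ i, H →L[ℝ] G i) (K : ∀ i, G i →L[ℝ] X i) (M : ∀ i, G i →L[ℝ] Y i)
    (τ : ℝ) (θ₁ θ₂ γ₁ γ₂ σ : ι → ℝ) (w : PrimalDualSpace H X Y G) : PrimalDualSpace H X Y G :=
  PrimalDualSpace.mk (τ⁻¹ • w.fst - ∑ i, adjoint (L i) (w.snd i).v)
    (fun i => (θ₁ i)⁻¹ • (w.snd i).p + K i (w.snd i).z)
    (fun i => (θ₂ i)⁻¹ • (w.snd i).q + M i (w.snd i).y)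
    (fun i => (γ₁ i)⁻¹ • (w.snd i).z + adjoint (K i) (w.snd i).p)
    (fun i => (γ₂ i)⁻¹ • (w.snd i).y + adjoint (M i) (w.snd i).q)
    (fun i => (σ i)⁻¹ • (w.snd i).v - L i w.fst)

theorem inner_metricMap (L : ∀ i, H →L[ℝ] G i) (K : ∀ i, G i →L[ℝ] X i)
    (M : ∀ i, G i →L[ℝ] Y i) (τ : ℝ) (θ₁ θ₂ γ₁ γ₂ σ : ι → ℝ) (a b : PrimalDualSpace H X Y G) :
    (⟪metricMap L K M τ θ₁ θ₂ γ₁ γ₂ σ a, b⟫ : ℝ) =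
      ⟪a, metricMap L K M τ θ₁ θ₂ γ₁ γ₂ σ b⟫ := by
  rw [PrimalDualSpace.inner_def, PrimalDualSpace.inner_def]
  simp only [metricMap, PrimalDualSpace.mk, DualBlock.q_mk, DualBlock.z_mk,
    DualBlock.y_mk, DualBlock.v_mk, WithLp.toLp_fst, WithLp.toLp_snd, sum_inner, inner_sum,
    ContinuousLinearMap.adjoint_inner_left, ContinuousLinearMap.adjoint_inner_right,
    inner_sub_left, inner_sub_right, inner_add_left, inner_add_right, real_inner_smul_left,
    real_inner_smul_right]
  rw [sub_add_eq_add_sub, sub_add_eq_add_sub, add_sub_assoc, add_sub_assoc,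
    ← Finset.sum_sub_distrib, ← Finset.sum_sub_distrib]
  congr 1
  exact Finset.sum_congr rfl fun i _ => by ring

theorem norm_sq_le_inner_metricMap {L : ∀ i, H →L[ℝ] G i} {K : ∀ i, G i →L[ℝ] X i}
    {M : ∀ i, G i →L[ℝ] Y i} {τ : ℝ} {θ₁ θ₂ γ₁ γ₂ σ : ι → ℝ} {α κ : ℝ}
    (hτ : 0 < τ) (hθ₁ : ∀ i, 0 < θ₁ i) (hθ₂ : ∀ i, 0 < θ₂ i) (hγ₁ : ∀ i, 0 < γ₁ i)
    (hγ₂ : ∀ i, 0 < γ₂ i) (hσ : ∀ i, 0 < σ i)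
    (hL : √(τ * ∑ i, σ i * ‖L i‖ ^ 2) ≤ α) (hK : ∀ i, √(θ₁ i * γ₁ i * ‖K i‖ ^ 2) ≤ α)
    (hM : ∀ i, √(θ₂ i * γ₂ i * ‖M i‖ ^ 2) ≤ α)
    (hκτ : κ ≤ (1 - α) * τ⁻¹) (hκ : ∀ i, κ ≤ (1 - α) * (θ₁ i)⁻¹ ∧ κ ≤ (1 - α) * (θ₂ i)⁻¹ ∧
      κ ≤ (1 - α) * (γ₁ i)⁻¹ ∧ κ ≤ (1 - α) * (γ₂ i)⁻¹ ∧ κ ≤ (1 - α) * (σ i)⁻¹)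
    (w : PrimalDualSpace H X Y G) :
    κ * ‖w‖ ^ 2 ≤ ⟪metricMap L K M τ θ₁ θ₂ γ₁ γ₂ σ w, w⟫ := by
  have hxv := abs_sum_inner_apply_le hτ hσ hL w.fst fun i => (w.snd i).v
  rw [← real_inner_self_eq_norm_sq, PrimalDualSpace.inner_def, PrimalDualSpace.inner_def]
  simp only [metricMap, PrimalDualSpace.mk, DualBlock.q_mk, DualBlock.z_mk,
    DualBlock.y_mk, DualBlock.v_mk, WithLp.toLp_fst, WithLp.toLp_snd, sum_inner,
    ContinuousLinearMap.adjoint_inner_left,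
    inner_sub_left, inner_add_left, real_inner_smul_left, real_inner_self_eq_norm_sq]
  have hblock : ∀ i, κ * (‖(w.snd i).p‖ ^ 2 + (‖(w.snd i).q‖ ^ 2 + (‖(w.snd i).z‖ ^ 2 +
      (‖(w.snd i).y‖ ^ 2 + ‖(w.snd i).v‖ ^ 2)))) ≤
      ((θ₁ i)⁻¹ * ‖(w.snd i).p‖ ^ 2 + ⟪K i (w.snd i).z, (w.snd i).p⟫ +
      ((θ₂ i)⁻¹ * ‖(w.snd i).q‖ ^ 2 + ⟪M i (w.snd i).y, (w.snd i).q⟫ +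
      ((γ₁ i)⁻¹ * ‖(w.snd i).z‖ ^ 2 + ⟪(w.snd i).p, K i (w.snd i).z⟫ +
      ((γ₂ i)⁻¹ * ‖(w.snd i).y‖ ^ 2 + ⟪(w.snd i).q, M i (w.snd i).y⟫ +
      ((σ i)⁻¹ * ‖(w.snd i).v‖ ^ 2 - ⟪L i w.fst, (w.snd i).v⟫))))) +
      (⟪(w.snd i).v, L i w.fst⟫ - α * ((σ i)⁻¹ * ‖(w.snd i).v‖ ^ 2)) := by
    intro i
    have h1 := abs_inner_apply_le (hθ₁ i) (hγ₁ i) (hK i) (w.snd i).z (w.snd i).p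
    have h2 := abs_inner_apply_le (hθ₂ i) (hγ₂ i) (hM i) (w.snd i).y (w.snd i).q
    have h1' := neg_abs_le (⟪K i (w.snd i).z, (w.snd i).p⟫ : ℝ)
    have h2' := neg_abs_le (⟪M i (w.snd i).y, (w.snd i).q⟫ : ℝ)
    obtain ⟨k1, k2, k3, k4, k5⟩ := hκ i
    rw [real_inner_comm (K i (w.snd i).z) (w.snd i).p,
      real_inner_comm (M i (w.snd i).y) (w.snd i).q, real_inner_comm (w.snd i).v (L i w.fst)]
    linarith [mul_le_mul_of_nonneg_right k1 (sq_nonneg ‖(w.snd i).p‖),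
      mul_le_mul_of_nonneg_right k2 (sq_nonneg ‖(w.snd i).q‖),
      mul_le_mul_of_nonneg_right k3 (sq_nonneg ‖(w.snd i).z‖),
      mul_le_mul_of_nonneg_right k4 (sq_nonneg ‖(w.snd i).y‖),
      mul_le_mul_of_nonneg_right k5 (sq_nonneg ‖(w.snd i).v‖)]
  have hsum := Finset.sum_le_sum fun i (_ : i ∈ Finset.univ) => hblock i
  simp only [Finset.sum_add_distrib, Finset.sum_sub_distrib, ← Finset.mul_sum] at hsum ⊢
  have hx := mul_le_mul_of_nonneg_right hκτ (sq_nonneg ‖w.fst‖)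
  have habs := le_abs_self (∑ i, (⟪(w.snd i).v, L i w.fst⟫ : ℝ))
  linarith

/-- The diagonal maximally monotone part of the optimality system. -/
def diagOp (c : H) (A : H → Set H) (B : ∀ i, X i → Set (X i)) (D : ∀ i, Y i → Set (Y i))
    (r : ∀ i, G i) : PrimalDualSpace H X Y G → Set (PrimalDualSpace H X Y G) :=
  prodOp (addMapOp A fun _ => -c) (piOp fun i => prodOp (invOp (B i)) (prodOp (invOp (D i))
    (prodOp (constOp 0) (prodOp (constOp 0) (constOp (r i))))))

omit [CompleteSpace H] [∀ i, CompleteSpace (G i)] [∀ i, CompleteSpace (X i)]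
  [∀ i, CompleteSpace (Y i)] in
theorem monoOp_diagOp {A : H → Set H} {B : ∀ i, X i → Set (X i)} {D : ∀ i, Y i → Set (Y i)}
    (hA : MonoOp A) (hB : ∀ i, MonoOp (B i)) (hD : ∀ i, MonoOp (D i)) (c : H) (r : ∀ i, G i) :
    MonoOp (diagOp c A B D r) :=
  (hA.addMapOp (by simp)).prodOp (monoOp_piOp fun i => (hB i).invOp.prodOp ((hD i).invOp.prodOp
    ((monoOp_constOp 0).prodOp ((monoOp_constOp 0).prodOp (monoOp_constOp (r i))))))

omit [CompleteSpace H] [∀ i, CompleteSpace (G i)] [∀ i, CompleteSpace (X i)]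
  [∀ i, CompleteSpace (Y i)] in
theorem graphMaximal_diagOp {A : H → Set H} {B : ∀ i, X i → Set (X i)}
    {D : ∀ i, Y i → Set (Y i)} (hA : GraphMaximal A) (hB : ∀ i, GraphMaximal (B i))
    (hD : ∀ i, GraphMaximal (D i)) (c : H) (r : ∀ i, G i) : GraphMaximal (diagOp c A B D r) :=
  (hA.addMapOp (by simp)).prodOp (graphMaximal_piOp fun i => (hB i).invOp.prodOp
    ((hD i).invOp.prodOp ((graphMaximal_constOp 0).prodOp
      ((graphMaximal_constOp 0).prodOp (graphMaximal_constOp (r i))))))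

theorem mem_addMapOp_diagOp_skewMap {c : H} {A : H → Set H} {B : ∀ i, X i → Set (X i)}
    {D : ∀ i, Y i → Set (Y i)} {r : ∀ i, G i} {L : ∀ i, H →L[ℝ] G i} {K : ∀ i, G i →L[ℝ] X i}
    {M : ∀ i, G i →L[ℝ] Y i} {u w : PrimalDualSpace H X Y G} :
    u ∈ addMapOp (diagOp c A B D r) (skewMap L K M) w ↔
      u.fst - ∑ i, adjoint (L i) (w.snd i).v + c ∈ A w.fst ∧
      ∀ i, (w.snd i).p ∈ B i ((u.snd i).p + K i (w.snd i).z) ∧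
        (w.snd i).q ∈ D i ((u.snd i).q + M i (w.snd i).y) ∧
        (u.snd i).z = adjoint (K i) (w.snd i).p - (w.snd i).v ∧
        (u.snd i).y = adjoint (M i) (w.snd i).q - (w.snd i).v ∧
        (u.snd i).v - ((w.snd i).z + (w.snd i).y - L i w.fst) = r i := by
  have h1 : u ∈ addMapOp (diagOp c A B D r) (skewMap L K M) w ↔
      u.fst - ∑ i, adjoint (L i) (w.snd i).v - -c ∈ A w.fst ∧
      ∀ i, (w.snd i).p ∈ B i ((u.snd i).p - -K i (w.snd i).z) ∧
        (w.snd i).q ∈ D i ((u.snd i).q - -M i (w.snd i).y) ∧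
        (u.snd i).z - (adjoint (K i) (w.snd i).p - (w.snd i).v) = 0 ∧
        (u.snd i).y - (adjoint (M i) (w.snd i).q - (w.snd i).v) = 0 ∧
        (u.snd i).v - ((w.snd i).z + (w.snd i).y - L i w.fst) = r i := Iff.rfl
  rw [h1]
  simp only [sub_neg_eq_add, sub_eq_zero]

theorem neg_toLp_mem_addMapOp_diagOp_skewMap {c c' : H} {A : H → Set H}
    {B : ∀ i, X i → Set (X i)} {D : ∀ i, Y i → Set (Y i)} {r : ∀ i, G i} {L : ∀ i, H →L[ℝ] G i}
    {K : ∀ i, G i →L[ℝ] X i} {M : ∀ i, G i →L[ℝ] Y i} {w : PrimalDualSpace H X Y G} :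
    -WithLp.toLp 2 (c', 0) ∈ addMapOp (diagOp c A B D r) (skewMap L K M) w ↔
      c - ∑ i, adjoint (L i) (w.snd i).v - c' ∈ A w.fst ∧
      ∀ i, (w.snd i).p ∈ B i (K i (w.snd i).z) ∧ (w.snd i).q ∈ D i (M i (w.snd i).y) ∧
        adjoint (K i) (w.snd i).p = (w.snd i).v ∧ adjoint (M i) (w.snd i).q = (w.snd i).v ∧
        L i w.fst - r i = (w.snd i).z + (w.snd i).y := by
  rw [mem_addMapOp_diagOp_skewMap]
  change -c' - ∑ i, adjoint (L i) (w.snd i).v + c ∈ A w.fst ∧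
      (∀ i, (w.snd i).p ∈ B i (-0 + K i (w.snd i).z) ∧
        (w.snd i).q ∈ D i (-0 + M i (w.snd i).y) ∧
        -0 = adjoint (K i) (w.snd i).p - (w.snd i).v ∧
        -0 = adjoint (M i) (w.snd i).q - (w.snd i).v ∧
        -0 - ((w.snd i).z + (w.snd i).y - L i w.fst) = r i) ↔ _
  have h1 : -c' - ∑ i, adjoint (L i) (w.snd i).v + c =
      c - ∑ i, adjoint (L i) (w.snd i).v - c' := by abel
  simp only [h1, neg_zero, zero_add, zero_sub, neg_sub, eq_comm (a := (0 : G _)),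
    sub_eq_iff_eq_add, add_comm (r _)]

theorem metricMap_sub_mem {c c' : H} {A : H → Set H}
    {B : ∀ i, X i → Set (X i)} {D : ∀ i, Y i → Set (Y i)} {r : ∀ i, G i} {L : ∀ i, H →L[ℝ] G i}
    {K : ∀ i, G i →L[ℝ] X i} {M : ∀ i, G i →L[ℝ] Y i} {τ : ℝ} {θ₁ θ₂ γ₁ γ₂ σ : ι → ℝ}
    (hτ : 0 < τ) (hθ₁ : ∀ i, 0 < θ₁ i) (hθ₂ : ∀ i, 0 < θ₂ i) (hγ₁ : ∀ i, 0 < γ₁ i)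
    (hγ₂ : ∀ i, 0 < γ₂ i) (hσ : ∀ i, 0 < σ i) {w j : PrimalDualSpace H X Y G}
    (hx : IsRes τ A (w.fst - τ • (c' + ∑ i, adjoint (L i) (w.snd i).v - c)) j.fst)
    (hp : ∀ i, IsRes (θ₁ i) (invOp (B i)) ((w.snd i).p + θ₁ i • K i (w.snd i).z) (j.snd i).p)
    (hq : ∀ i, IsRes (θ₂ i) (invOp (D i)) ((w.snd i).q + θ₂ i • M i (w.snd i).y) (j.snd i).q)
    (hz : ∀ i, (j.snd i).z = (w.snd i).z +
      γ₁ i • (adjoint (K i) ((w.snd i).p - (2 : ℝ) • (j.snd i).p) + (j.snd i).v))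
    (hy : ∀ i, (j.snd i).y = (w.snd i).y +
      γ₂ i • (adjoint (M i) ((w.snd i).q - (2 : ℝ) • (j.snd i).q) + (j.snd i).v))
    (hv : ∀ i, (j.snd i).v = (w.snd i).v +
      σ i • (L i ((2 : ℝ) • j.fst - w.fst) - r i - ((j.snd i).z + (j.snd i).y))) :
    metricMap L K M τ θ₁ θ₂ γ₁ γ₂ σ (w - j) - WithLp.toLp 2 (c', 0) ∈
      addMapOp (diagOp c A B D r) (skewMap L K M) j := by
  refine mem_addMapOp_diagOp_skewMap.2 ⟨?_, fun i => ⟨?_, ?_, ?_, ?_, ?_⟩⟩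
  · change τ⁻¹ • (w.fst - j.fst) - ∑ i, adjoint (L i) ((w.snd i).v - (j.snd i).v) - c'
        - ∑ i, adjoint (L i) (j.snd i).v + c ∈ A j.fst
    convert hx.inv_smul_mem hτ using 1
    have := hτ.ne'
    simp only [map_sub, Finset.sum_sub_distrib]
    match_scalars <;> field_simp
    ring
  · change (θ₁ i)⁻¹ • ((w.snd i).p - (j.snd i).p) + K i ((w.snd i).z - (j.snd i).z) - 0
        + K i (j.snd i).z ∈ invOp (B i) (j.snd i).p
    convert (hp i).inv_smul_mem (hθ₁ i) using 1
    have := (hθ₁ i).ne'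
    rw [map_sub]
    match_scalars <;> field_simp
    ring
  · change (θ₂ i)⁻¹ • ((w.snd i).q - (j.snd i).q) + M i ((w.snd i).y - (j.snd i).y) - 0
        + M i (j.snd i).y ∈ invOp (D i) (j.snd i).q
    convert (hq i).inv_smul_mem (hθ₂ i) using 1
    have := (hθ₂ i).ne'
    rw [map_sub]
    match_scalars <;> field_simp
    ring
  · change (γ₁ i)⁻¹ • ((w.snd i).z - (j.snd i).z) + adjoint (K i) ((w.snd i).p - (j.snd i).p) - 0
        = _
    rw [sub_zero, map_sub]
    exact inv_smul_sub_add_sub_eq (hγ₁ i) (by rw [hz i, map_sub, map_smul])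
  · change (γ₂ i)⁻¹ • ((w.snd i).y - (j.snd i).y) + adjoint (M i) ((w.snd i).q - (j.snd i).q) - 0
        = _
    rw [sub_zero, map_sub]
    exact inv_smul_sub_add_sub_eq (hγ₂ i) (by rw [hy i, map_sub, map_smul])
  · change (σ i)⁻¹ • ((w.snd i).v - (j.snd i).v) - L i (w.fst - j.fst) - 0
        - ((j.snd i).z + (j.snd i).y - L i j.fst) = r i
    have := (hσ i).ne'
    rw [hv i]
    simp only [map_sub, map_smul]
    match_scalars <;> field_simp <;> ring

end PrimalDual

set_option maxHeartbeats 400000 in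
theorem stmt0 {m : ℕ}
    {H : Type*} [NormedAddCommGroup H] [InnerProductSpace ℝ H] [CompleteSpace H]
    {G : Fin m → Type*} [∀ i, NormedAddCommGroup (G i)] [∀ i, InnerProductSpace ℝ (G i)]
    [∀ i, CompleteSpace (G i)]
    {X : Fin m → Type*} [∀ i, NormedAddCommGroup (X i)] [∀ i, InnerProductSpace ℝ (X i)]
    [∀ i, CompleteSpace (X i)]
    {Y : Fin m → Type*} [∀ i, NormedAddCommGroup (Y i)] [∀ i, InnerProductSpace ℝ (Y i)]
    [∀ i, CompleteSpace (Y i)]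
    (z : H) (A : H → Set H) (hA : MaxMonoOp A)
    (μ : ℝ) (hμ : 0 < μ) (C : H → H)
    (hCmono : ∀ x y : H, (0:ℝ) ≤ ⟪x - y, C x - C y⟫)
    (r : ∀ i, G i)
    (B : ∀ i, X i → Set (X i)) (hB : ∀ i, MaxMonoOp (B i))
    (D : ∀ i, Y i → Set (Y i)) (hD : ∀ i, MaxMonoOp (D i))
    (L : ∀ i, H →L[ℝ] G i) (hL : ∀ i, L i ≠ 0)
    (K : ∀ i, G i →L[ℝ] X i) (hK : ∀ i, K i ≠ 0)
    (M : ∀ i, G i →L[ℝ] Y i) (hM : ∀ i, M i ≠ 0)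
    (hCco : ∀ x y : H, μ⁻¹ * ‖C x - C y‖ ^ 2 ≤ ⟪x - y, C x - C y⟫)
    -- step sizes
    (τ : ℝ) (hτ : 0 < τ)
    (θ1 θ2 γ1 γ2 σ : Fin m → ℝ)
    (hθ1 : ∀ i, 0 < θ1 i) (hθ2 : ∀ i, 0 < θ2 i)
    (hγ1 : ∀ i, 0 < γ1 i) (hγ2 : ∀ i, 0 < γ2 i) (hσ : ∀ i, 0 < σ i)
    (α : ℝ)
    (hα : IsGreatest ({Real.sqrt (τ * ∑ i, σ i * ‖L i‖ ^ 2)} ∪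
        Set.range (fun j => Real.sqrt (θ1 j * γ1 j * ‖K j‖ ^ 2)) ∪
        Set.range (fun j => Real.sqrt (θ2 j * γ2 j * ‖M j‖ ^ 2))) α)
    -- `2 μ⁻¹ (1 - α) · min{1/τ, 1/θ1ᵢ, 1/θ2ᵢ, 1/γ1ᵢ, 1/γ2ᵢ, 1/σᵢ} > 1`
    (hstep : 1 < 2 * μ⁻¹ * (1 - α) * (1 / τ) ∧ ∀ i,
        1 < 2 * μ⁻¹ * (1 - α) * (1 / θ1 i) ∧ 1 < 2 * μ⁻¹ * (1 - α) * (1 / θ2 i) ∧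
        1 < 2 * μ⁻¹ * (1 - α) * (1 / γ1 i) ∧ 1 < 2 * μ⁻¹ * (1 - α) * (1 / γ2 i) ∧
        1 < 2 * μ⁻¹ * (1 - α) * (1 / σ i))
    -- range condition
    (hran : ∃ (x : H) (u : H) (w : ∀ i, G i), u ∈ A x ∧
        (∀ i, w i ∈ parOp (compOp (K i) (B i)) (compOp (M i) (D i)) (L i x - r i)) ∧
        z = u + ∑ i, ContinuousLinearMap.adjoint (L i) (w i) + C x)
    -- relaxation parameters
    (ε : ℝ) (hε : ε ∈ Set.Ioo (0:ℝ) 1) (lam : ℕ → ℝ) (hlam : ∀ n, lam n ∈ Set.Icc ε 1)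
    -- the sequences generated by Algorithm 3.1
    (x xt : ℕ → H)
    (p pt : ℕ → ∀ i, X i) (q qt : ℕ → ∀ i, Y i)
    (zz zt y yt v vt u1 u2 : ℕ → ∀ i, G i)
    (hxt : ∃ j : ℕ → H,
      (∀ n, IsRes τ A
        (x n - τ • (C (x n) + ∑ i, ContinuousLinearMap.adjoint (L i) (v n i) - z)) (j n)) ∧
      Summable (fun n => ‖xt n - j n‖))
    (hpt : ∀ i, ∃ j : ℕ → X i,
      (∀ n, IsRes (θ1 i) (invOp (B i)) (p n i + θ1 i • K i (zz n i)) (j n)) ∧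
      Summable (fun n => ‖pt n i - j n‖))
    (hqt : ∀ i, ∃ j : ℕ → Y i,
      (∀ n, IsRes (θ2 i) (invOp (D i)) (q n i + θ2 i • M i (y n i)) (j n)) ∧
      Summable (fun n => ‖qt n i - j n‖))
    (hu1 : ∀ i, Summable (fun n => ‖u1 n i - (zz n i + γ1 i •
        (ContinuousLinearMap.adjoint (K i) (p n i - (2:ℝ) • pt n i) + v n i +
          σ i • (L i ((2:ℝ) • xt n - x n) - r i)))‖))
    (hu2 : ∀ i, Summable (fun n => ‖u2 n i - (y n i + γ2 i •
        (ContinuousLinearMap.adjoint (M i) (q n i - (2:ℝ) • qt n i) + v n i +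
          σ i • (L i ((2:ℝ) • xt n - x n) - r i)))‖))
    (hzt : ∀ i, Summable (fun n => ‖zt n i -
        ((1 + σ i * γ2 i) / (1 + σ i * (γ1 i + γ2 i))) •
          (u1 n i - (σ i * γ1 i / (1 + σ i * γ2 i)) • u2 n i)‖))
    (hyt : ∀ i, Summable (fun n => ‖yt n i -
        (1 / (1 + σ i * γ2 i)) • (u2 n i - (σ i * γ2 i) • zt n i)‖))
    (hvt : ∀ i, Summable (fun n => ‖vt n i -
        (v n i + σ i • (L i ((2:ℝ) • xt n - x n) - r i - zt n i - yt n i))‖))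
    (hx : ∀ n, x (n+1) = x n + lam n • (xt n - x n))
    (hp : ∀ n i, p (n+1) i = p n i + lam n • (pt n i - p n i))
    (hq : ∀ n i, q (n+1) i = q n i + lam n • (qt n i - q n i))
    (hz : ∀ n i, zz (n+1) i = zz n i + lam n • (zt n i - zz n i))
    (hy : ∀ n i, y (n+1) i = y n i + lam n • (yt n i - y n i))
    (hv : ∀ n i, v (n+1) i = v n i + lam n • (vt n i - v n i))
    :
    ∃ (xb : H) (pb : ∀ i, X i) (qb : ∀ i, Y i) (yb : ∀ i, G i),
      (z - ∑ i, ContinuousLinearMap.adjoint (L i)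
          (ContinuousLinearMap.adjoint (K i) (pb i)) - C xb ∈ A xb) ∧
      (∀ i, K i (L i xb - yb i - r i) ∈ invOp (B i) (pb i)) ∧
      (∀ i, M i (yb i) ∈ invOp (D i) (qb i)) ∧
      (∀ i, ContinuousLinearMap.adjoint (K i) (pb i) =
          ContinuousLinearMap.adjoint (M i) (qb i)) ∧
      WConv x xb ∧
      (∀ i, WConv (fun n => p n i) (pb i)) ∧
      (∀ i, WConv (fun n => q n i) (qb i)) ∧
      (∀ i, WConv (fun n => y n i) (yb i)) := by
  have hμ' : 0 < μ⁻¹ := inv_pos.2 hμ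
  obtain ⟨κ, hκμ, hκτ, hκ⟩ : ∃ κ, μ / 2 < κ ∧ κ ≤ (1 - α) * τ⁻¹ ∧ ∀ i,
      κ ≤ (1 - α) * (θ1 i)⁻¹ ∧ κ ≤ (1 - α) * (θ2 i)⁻¹ ∧ κ ≤ (1 - α) * (γ1 i)⁻¹ ∧
      κ ≤ (1 - α) * (γ2 i)⁻¹ ∧ κ ≤ (1 - α) * (σ i)⁻¹ := by
    have key : ∀ t : ℝ, 1 < 2 * μ⁻¹ * (1 - α) * (1 / t) →
        ∀ᶠ κ in 𝓝[>] (μ / 2), κ ≤ (1 - α) * t⁻¹ := by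
      intro t ht
      have hlt : μ / 2 < (1 - α) * t⁻¹ := by
        calc μ / 2 = μ / 2 * 1 := (mul_one _).symm
          _ < μ / 2 * (2 * μ⁻¹ * (1 - α) * (1 / t)) := by gcongr
          _ = (1 - α) * t⁻¹ := by field_simp
      filter_upwards [Ioc_mem_nhdsGT hlt] with κ hκ using hκ.2
    have hev : ∀ᶠ κ in 𝓝[>] (μ / 2), μ / 2 < κ ∧ κ ≤ (1 - α) * τ⁻¹ ∧ ∀ i,
        κ ≤ (1 - α) * (θ1 i)⁻¹ ∧ κ ≤ (1 - α) * (θ2 i)⁻¹ ∧ κ ≤ (1 - α) * (γ1 i)⁻¹ ∧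
        κ ≤ (1 - α) * (γ2 i)⁻¹ ∧ κ ≤ (1 - α) * (σ i)⁻¹ := by
      refine eventually_mem_nhdsWithin.and ((key τ hstep.1).and (eventually_all.2 fun i => ?_))
      obtain ⟨h1, h2, h3, h4, h5⟩ := hstep.2 i
      exact (key _ h1).and ((key _ h2).and ((key _ h3).and ((key _ h4).and (key _ h5))))
    exact hev.exists
  have hμκ : 1 < 2 * μ⁻¹ * κ := by
    calc (1 : ℝ) = 2 * μ⁻¹ * (μ / 2) := by field_simp
      _ < 2 * μ⁻¹ * κ := by gcongr
  obtain ⟨jx, hjx, hjxs⟩ := hxt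
  choose jp hjp hjps using hpt
  choose jq hjq hjqs using hqt
  have hstep_dual := fun i => exists_exact_dual_step (hσ i) (hγ1 i) (hγ2 i)
    (g' := fun n => L i ((2 : ℝ) • jx n - x n) - r i)
    (a₁' := fun n => ContinuousLinearMap.adjoint (K i) (p n i - (2 : ℝ) • jp i n))
    (a₂' := fun n => ContinuousLinearMap.adjoint (M i) (q n i - (2 : ℝ) • jq i n))
    (((hjxs.norm_clm_apply (L i)).norm_const_smul 2).congr fun n => by
      congr 1
      simp only [map_sub, map_smul]
      module)
    ((((hjps i).norm_clm_apply (ContinuousLinearMap.adjoint (K i))).norm_const_smul (-2)).congr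
      fun n => by
        congr 1
        simp only [map_sub, map_smul]
        module)
    ((((hjqs i).norm_clm_apply (ContinuousLinearMap.adjoint (M i))).norm_const_smul (-2)).congr
      fun n => by
        congr 1
        simp only [map_sub, map_smul]
        module)
    (hu1 i) (hu2 i) (hzt i) (hyt i) (hvt i)
  choose jz jy jv hjz hjy hjv hjzs hjys hjvs using hstep_dual
  let V : PrimalDualSpace H X Y G →ₗ[ℝ] PrimalDualSpace H X Y G :=
    LinearMap.ofSymmetric (metricMap L K M τ θ1 θ2 γ1 γ2 σ)
      (inner_metricMap L K M τ θ1 θ2 γ1 γ2 σ)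
  let Q : PrimalDualSpace H X Y G → PrimalDualSpace H X Y G := fun a => WithLp.toLp 2 (C a.fst, 0)
  have hskew := inner_sub_sub_eq_zero_of_skew (inner_skewMap L K M)
  have hQ : ∀ a b, μ⁻¹ * ‖Q a - Q b‖ ^ 2 ≤ ⟪a - b, Q a - Q b⟫ := by
    intro a b
    rw [WithLp.prod_norm_sq_eq_of_L2, WithLp.prod_inner_apply]
    simpa [Q] using hCco a.fst b.fst
  have hzero : ∃ a, -Q a ∈ addMapOp (diagOp z A B D r) (skewMap L K M) a := by
    obtain ⟨x₀, u, w, hu, hw, hz₀⟩ := hran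
    choose a ha b hb hab using hw
    choose p₀ hp₀ hKp₀ using ha
    choose q₀ hq₀ hMq₀ using hb
    refine ⟨PrimalDualSpace.mk x₀ p₀ q₀ a b w, neg_toLp_mem_addMapOp_diagOp_skewMap.2
      ⟨?_, fun i => ⟨hp₀ i, hq₀ i, hKp₀ i, hMq₀ i, hab i⟩⟩⟩
    change z - ∑ i, ContinuousLinearMap.adjoint (L i) (w i) - C x₀ ∈ A x₀
    convert hu using 1
    rw [hz₀]
    abel
  let w : ℕ → PrimalDualSpace H X Y G := fun n =>
    PrimalDualSpace.mk (x n) (p n) (q n) (zz n) (y n) (v n)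
  let wt : ℕ → PrimalDualSpace H X Y G := fun n =>
    PrimalDualSpace.mk (xt n) (pt n) (qt n) (zt n) (yt n) (vt n)
  let j : ℕ → PrimalDualSpace H X Y G := fun n =>
    PrimalDualSpace.mk (jx n) (fun i => jp i n) (fun i => jq i n)
      (fun i => jz i n) (fun i => jy i n) (fun i => jv i n)
  have hj : ∀ n, V (w n - j n) - Q (w n) ∈
      addMapOp (diagOp z A B D r) (skewMap L K M) (j n) := fun n =>
    metricMap_sub_mem hτ hθ1 hθ2 hγ1 hγ2 hσ (hjx n) (fun i => hjp i n) (fun i => hjq i n)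
      (fun i => hjz i n) (fun i => hjy i n) (fun i => hjv i n)
  have hsum : Summable fun n => ‖wt n - j n‖ :=
    hjxs.norm_toLp_prod (summable_norm_toLp_pi fun i => (hjps i).norm_toLp_prod
      ((hjqs i).norm_toLp_prod ((hjzs i).norm_toLp_prod ((hjys i).norm_toLp_prod (hjvs i)))))
  have hw : ∀ n, w (n + 1) = w n + lam n • (wt n - w n) := by
    intro n
    have h : ∀ i, DualBlock.mk (p (n + 1) i) (q (n + 1) i) (zz (n + 1) i) (y (n + 1) i)
        (v (n + 1) i) = DualBlock.mk (p n i + lam n • (pt n i - p n i))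
        (q n i + lam n • (qt n i - q n i)) (zz n i + lam n • (zt n i - zz n i))
        (y n i + lam n • (yt n i - y n i)) (v n i + lam n • (vt n i - v n i)) := fun i => by
      rw [hp, hq, hz, hy, hv]
    change WithLp.toLp 2 (x (n + 1), WithLp.toLp 2 fun i => _) = _
    rw [hx, funext h]
    rfl
  obtain ⟨a, ha, hconv⟩ := exists_wConv_of_forward_backward
    ((monoOp_diagOp hA.1 (fun i => (hB i).1) (fun i => (hD i).1) z r).addMapOp hskew)
    ((graphMaximal_diagOp hA.graphMaximal (fun i => (hB i).graphMaximal)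
      (fun i => (hD i).graphMaximal) z r).addMapOp hskew)
    hμ' (by linarith) hμκ hQ (V := V) (inner_metricMap L K M τ θ1 θ2 γ1 γ2 σ)
    (norm_sq_le_inner_metricMap hτ hθ1 hθ2 hγ1 hγ2 hσ (hα.2 (by simp))
      (fun i => hα.2 (by simp)) (fun i => hα.2 (by simp)) hκτ hκ)
    hzero hε.1 hlam hj hsum hw
  obtain ⟨hxA, hblock⟩ := neg_toLp_mem_addMapOp_diagOp_skewMap.1 ha
  choose hB' hD' hKp hMq hr using hblock
  have hblock : ∀ i, WConv (fun n => (w n).snd i) (a.snd i) := fun i =>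
    (hconv.map (WithLp.sndL 2 ℝ _ _)).map (PiLp.proj 2 _ i)
  refine ⟨a.fst, fun i => (a.snd i).p, fun i => (a.snd i).q, fun i => (a.snd i).y,
    ?_, fun i => ?_, hD', fun i => (hKp i).trans (hMq i).symm,
    hconv.map (WithLp.fstL 2 ℝ _ _), fun i => (hblock i).map (WithLp.fstL 2 ℝ _ _),
    fun i => ((hblock i).map (WithLp.sndL 2 ℝ _ _)).map (WithLp.fstL 2 ℝ _ _),
    fun i => ((((hblock i).map (WithLp.sndL 2 ℝ _ _)).map (WithLp.sndL 2 ℝ _ _)).map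
      (WithLp.sndL 2 ℝ _ _)).map (WithLp.fstL 2 ℝ _ _)⟩
  · simpa only [hKp] using hxA
  · rw [sub_right_comm, hr i, add_sub_cancel_right]
    exact hB' i
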